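/- Let (Y, ⪯, id, □, ⁻¹) be an ore and let f, g be admissible elements with f⁻¹ ∧ g = id. Then f □ g is admissible. -/

import Mathlib

noncomputable section

/-- The data of an ore together with axioms (O1), (O2) and (O3): a partial order `le`
with binary meets and bottom element `idY` (O1), a cancellative monoid structure `op`
with identity `idY` and involution `inv` (O2), such that `le x y` holds iff `y = op x z`
for some `z` (O3). -/
structure OreData (Y : Type) where
  le : Y → Y → Prop
  idY : Y
  op : Y → Y → Y
  inv : Y → Y
  meet : Y → Y → Y
  le_refl : ∀ x, le x x
  le_antisymm : ∀ x y, le x y → le y x → x = y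
  le_trans : ∀ x y z, le x y → le y z → le x z
  meet_le_left : ∀ x y, le (meet x y) x
  meet_le_right : ∀ x y, le (meet x y) y
  le_meet : ∀ x y z, le z x → le z y → le z (meet x y)
  id_le : ∀ x, le idY x
  op_assoc : ∀ x y z, op (op x y) z = op x (op y z)
  op_id : ∀ x, op x idY = x
  id_op : ∀ x, op idY x = x
  cancel_left : ∀ x y z, op x y = op x z → y = z
  cancel_right : ∀ x y z, op x z = op y z → x = y
  inv_invol : ∀ x, inv (inv x) = x
  inv_op : ∀ x y, inv (op x y) = op (inv y) (inv x)
  le_iff : ∀ x y, le x y ↔ ∃ z, y = op x z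

namespace OreData

variable {Y : Type} (O : OreData Y)

/-- An element is admissible if it is not of the form `x □ y □ y⁻¹ □ z` with `y ≠ id`. -/
def Admissible (f : Y) : Prop :=
  ¬ ∃ x y z : Y, y ≠ O.idY ∧ f = O.op (O.op (O.op x y) (O.inv y)) z

/-- `j` is the least upper bound of `x` and `y`. -/
def IsJoin (x y j : Y) : Prop :=
  O.le x j ∧ O.le y j ∧ ∀ s, O.le x s → O.le y s → O.le j s

/-- `j` is the least upper bound of `x`, `y`, `z`. -/
def IsJoin3 (x y z j : Y) : Prop :=
  O.le x j ∧ O.le y j ∧ O.le z j ∧ ∀ s, O.le x s → O.le y s → O.le z s → O.le j s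

/-- `j` is the least upper bound of `x`, `y`, `z` within the admissible elements. -/
def IsJoin3G (x y z j : Y) : Prop :=
  O.Admissible j ∧ O.le x j ∧ O.le y j ∧ O.le z j ∧
    ∀ s, O.Admissible s → O.le x s → O.le y s → O.le z s → O.le j s

/-- `x` and `y` are orthogonal: their meet is `id` and their join exists. -/
def Orth (x y : Y) : Prop := O.meet x y = O.idY ∧ ∃ j, O.IsJoin x y j

/-- Axiom (O4): the admissible elements form a median semilattice. -/
def O4 : Prop :=
  ∀ a b c : Y, O.Admissible a → O.Admissible b → O.Admissible c →
    ∃ m : Y, O.IsJoin3G (O.meet a b) (O.meet b c) (O.meet a c) m ∧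
      ∀ x : Y, O.Admissible x →
        O.IsJoin3G (O.meet x (O.meet a b)) (O.meet x (O.meet b c))
          (O.meet x (O.meet a c)) (O.meet x m)

/-- Axiom (O5). -/
def O5 : Prop :=
  ∀ x y y' : Y, O.Orth x y → O.Admissible x → O.Admissible y' →
    O.IsJoin x y (O.op x y') → O.Admissible y

/-- Axiom (O6). -/
def O6 : Prop :=
  ∀ x y x' y' : Y, O.Admissible x → O.Admissible y → O.Orth x y →
    O.IsJoin x y (O.op x y') → O.IsJoin x y (O.op y x') →
    O.Admissible x' ∧ O.Admissible y' ∧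
    O.Orth (O.inv x) y' ∧ O.Orth (O.inv y) x' ∧
    O.IsJoin (O.inv x) y' (O.op (O.inv x) y) ∧
    O.op (O.inv x) y = O.op y' (O.inv x') ∧
    O.IsJoin (O.inv y) x' (O.inv (O.op (O.inv x) y))

/-- `(Y, ⪯, id, □, ⁻¹)` is an ore: axioms (O1)–(O3) hold by the `OreData` structure and
axioms (O4)–(O6) hold as well. -/
def IsOre : Prop := O.O4 ∧ O.O5 ∧ O.O6

open Classical in
/-- `y ∹ x`: the unique `z` with `y = x □ z` (if it exists; junk value otherwise). -/
def rdiv (y x : Y) : Y :=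
  if h : ∃ z, y = O.op x z then h.choose else O.idY

open Classical in
/-- `y ∸ z`: the unique `x` with `y = x □ z` (if it exists; junk value otherwise). -/
def ldiv (y z : Y) : Y :=
  if h : ∃ x, y = O.op x z then h.choose else O.idY

/-- The star product `f ⋆ g = (f ∸ (f⁻¹ ∧ g)⁻¹) □ (g ∹ (f⁻¹ ∧ g))`. -/
def star (f g : Y) : Y :=
  O.op (O.ldiv f (O.inv (O.meet (O.inv f) g))) (O.rdiv g (O.meet (O.inv f) g))

end OreData

namespace OreData

variable {Y : Type} {O : OreData Y}

theorem le_op (x z : Y) : O.le x (O.op x z) := (O.le_iff _ _).2 ⟨z, rfl⟩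

theorem eq_idY_of_le_idY {x : Y} (h : O.le x O.idY) : x = O.idY :=
  O.le_antisymm _ _ h (O.id_le x)

theorem eq_idY_of_le_of_le {a b c : Y} (h : O.meet a b = O.idY) (ha : O.le c a)
    (hb : O.le c b) : c = O.idY :=
  eq_idY_of_le_idY (h ▸ O.le_meet _ _ _ ha hb)

theorem meet_eq_idY_of_le {a b a' b' : Y} (h : O.meet a b = O.idY) (ha : O.le a' a)
    (hb : O.le b' b) : O.meet a' b' = O.idY :=
  eq_idY_of_le_of_le h (O.le_trans _ _ _ (O.meet_le_left _ _) ha)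
    (O.le_trans _ _ _ (O.meet_le_right _ _) hb)

theorem op_le_op_iff {u a b : Y} : O.le (O.op u a) (O.op u b) ↔ O.le a b := by
  rw [O.le_iff, O.le_iff]
  constructor
  · rintro ⟨z, hz⟩
    exact ⟨z, O.cancel_left u _ _ (by rw [hz, O.op_assoc])⟩
  · rintro ⟨z, rfl⟩
    exact ⟨z, (O.op_assoc _ _ _).symm⟩

theorem inv_idY : O.inv O.idY = O.idY := by
  have h := O.inv_op (O.inv O.idY) O.idY
  rw [O.op_id, O.inv_invol, O.op_id] at h
  exact h.symm

theorem inv_eq_idY {x : Y} (h : O.inv x = O.idY) : x = O.idY := by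
  rw [← O.inv_invol x, h, inv_idY]

theorem Admissible.of_op_left {u v : Y} (h : O.Admissible (O.op u v)) : O.Admissible u := by
  rintro ⟨x, y, z, hy, rfl⟩
  exact h ⟨x, y, O.op z v, hy, O.op_assoc _ _ _⟩

theorem Admissible.of_op_right {u v : Y} (h : O.Admissible (O.op u v)) : O.Admissible v := by
  rintro ⟨x, y, z, hy, rfl⟩
  exact h ⟨O.op u x, y, z, hy, by simp only [O.op_assoc]⟩

theorem Admissible.of_le {u v : Y} (h : O.Admissible v) (huv : O.le u v) : O.Admissible u := by
  obtain ⟨z, rfl⟩ := (O.le_iff _ _).1 huv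
  exact h.of_op_left

theorem Admissible.inv {u : Y} (h : O.Admissible u) : O.Admissible (O.inv u) := by
  rintro ⟨x, y, z, hy, hu⟩
  refine h ⟨O.inv z, y, O.inv x, hy, ?_⟩
  rw [← O.inv_invol u, hu]
  simp only [O.inv_op, O.inv_invol, O.op_assoc]

theorem Admissible.eq_idY {x y z : Y}
    (h : O.Admissible (O.op x (O.op y (O.op (O.inv y) z)))) : y = O.idY := by
  by_contra hy
  exact h ⟨x, y, z, hy, by simp only [O.op_assoc]⟩

theorem exists_meet_factorization (a b : Y) :
    ∃ p a' b', a = O.op p a' ∧ b = O.op p b' ∧ O.meet a' b' = O.idY := by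
  obtain ⟨a', ha⟩ := (O.le_iff _ _).1 (O.meet_le_left a b)
  obtain ⟨b', hb⟩ := (O.le_iff _ _).1 (O.meet_le_right a b)
  refine ⟨O.meet a b, a', b', ha, hb, ?_⟩
  have h : O.le (O.op (O.meet a b) (O.meet a' b')) (O.op (O.meet a b) O.idY) := by
    rw [O.op_id]
    refine O.le_meet _ _ _ ?_ ?_
    · conv_rhs => rw [ha]
      exact op_le_op_iff.2 (O.meet_le_left _ _)
    · conv_rhs => rw [hb]
      exact op_le_op_iff.2 (O.meet_le_right _ _)
  exact eq_idY_of_le_idY (op_le_op_iff.1 h)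

/-- Two elements with a common upper bound have a join: divide the complements by their
greatest common right divisor. -/
theorem exists_join_of_op_eq_op {a b c d : Y} (h : O.op a c = O.op b d) :
    ∃ c' d' r, c = O.op c' r ∧ d = O.op d' r ∧ O.op a c' = O.op b d' ∧
      O.IsJoin a b (O.op a c') := by
  obtain ⟨p, u, v, hu, hv, huv⟩ := O.exists_meet_factorization (O.inv c) (O.inv d)
  have hc : c = O.op (O.inv u) (O.inv p) := by rw [← O.inv_op, ← hu, O.inv_invol]
  have hd : d = O.op (O.inv v) (O.inv p) := by rw [← O.inv_op, ← hv, O.inv_invol]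
  have he : O.op a (O.inv u) = O.op b (O.inv v) := by
    apply O.cancel_right _ _ (O.inv p)
    rw [O.op_assoc, O.op_assoc, ← hc, ← hd, h]
  refine ⟨_, _, _, hc, hd, he, le_op _ _, he ▸ le_op _ _, fun s has hbs => ?_⟩
  have hat := O.le_meet _ _ _ (le_op a (O.inv u)) has
  have hbt := O.le_meet _ _ _ (he ▸ le_op b (O.inv v)) hbs
  obtain ⟨k, hk⟩ := (O.le_iff _ _).1 (O.meet_le_left (O.op a (O.inv u)) s)
  obtain ⟨e, hae⟩ := (O.le_iff _ _).1 hat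
  obtain ⟨e', hbe⟩ := (O.le_iff _ _).1 hbt
  have h1 : O.inv u = O.op e k := by
    apply O.cancel_left a
    rw [← O.op_assoc, ← hae, ← hk]
  have h2 : O.inv v = O.op e' k := by
    apply O.cancel_left b
    rw [← O.op_assoc, ← hbe, ← hk, he]
  have hku : O.le (O.inv k) u := by
    rw [← O.inv_invol u, h1, O.inv_op]; exact le_op _ _
  have hkv : O.le (O.inv k) v := by
    rw [← O.inv_invol v, h2, O.inv_op]; exact le_op _ _
  have hk1 : k = O.idY := inv_eq_idY (eq_idY_of_le_of_le huv hku hkv)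
  rw [hk1, O.op_id] at hk
  rw [hk]
  exact O.meet_le_right _ _

/-- Transporting an initial factor `x`, coprime to `f`, across a geodesic concatenation
`f □ g`: the remainder is again a geodesic concatenation of admissible elements. -/
theorem IsOre.exists_transport (hO : O.IsOre) {f g x w : Y} (hf : O.Admissible f)
    (hg : O.Admissible g) (hfg : O.meet (O.inv f) g = O.idY) (hfx : O.meet f x = O.idY)
    (h : O.op f g = O.op x w) :
    ∃ x' f' r, O.Admissible f' ∧ g = O.op x' r ∧ w = O.op f' r ∧
      O.op f x' = O.op x f' ∧ O.IsJoin (O.inv f) x' (O.op (O.inv f) x) ∧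
      O.op (O.inv f) x = O.op x' (O.inv f') ∧
      O.IsJoin (O.inv x) f' (O.inv (O.op (O.inv f) x)) ∧
      O.meet (O.inv f') r = O.idY := by
  obtain ⟨-, hO5, hO6⟩ := hO
  obtain ⟨x', f', r, hgr, hwr, hxf, hj⟩ := exists_join_of_op_eq_op h
  have hx' : O.Admissible x' := by rw [hgr] at hg; exact hg.of_op_left
  have horth : O.Orth f x := ⟨hfx, _, hj⟩
  have hx : O.Admissible x := hO5 _ _ _ horth hf hx' hj
  obtain ⟨hf', -, -, -, hj1, he1, hj2⟩ := hO6 f x f' x' hf hx horth hj (hxf ▸ hj)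
  refine ⟨x', f', r, hf', hgr, hwr, hxf, hj1, he1, hj2, ?_⟩
  obtain ⟨e, he⟩ := (O.le_iff _ _).1 (O.meet_le_left (O.inv f') r)
  have hcr := O.meet_le_right (O.inv f') r
  generalize O.meet (O.inv f') r = c at he hcr ⊢
  have hle : O.le (O.op x' c) g := by rw [hgr]; exact op_le_op_iff.2 hcr
  have heq : O.op (O.inv f) x = O.op (O.op x' c) e := by rw [he1, he, O.op_assoc]
  have hjc : O.IsJoin (O.inv f) (O.op x' c) (O.op (O.inv f) x) :=
    ⟨le_op _ _, heq ▸ le_op _ _,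
      fun s h1 h2 => hj1.2.2 s h1 (O.le_trans _ _ _ (le_op _ _) h2)⟩
  have hjf := (hO6 (O.inv f) (O.op x' c) e x hf.inv (hg.of_le hle)
    ⟨meet_eq_idY_of_le hfg (O.le_refl _) hle, _, hjc⟩ hjc (heq ▸ hjc)).2.2.2.2.1
  rw [O.inv_invol] at hjf
  have := hjf.2.2 _ hj.1 hj.2.1
  rw [op_le_op_iff] at this
  conv at this => rhs; rw [← O.op_id x']
  exact eq_idY_of_le_idY (op_le_op_iff.1 this)

theorem meet_inv_eq_idY_of_op {p f g : Y} (h : O.meet (O.inv (O.op p f)) g = O.idY) :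
    O.meet (O.inv f) g = O.idY :=
  meet_eq_idY_of_le h (by rw [O.inv_op]; exact le_op _ _) (O.le_refl _)

theorem IsOre.eq_idY_of_op_eq_op_inv (hO : O.IsOre) {f g y z : Y} (hf : O.Admissible f)
    (hg : O.Admissible g) (hfg : O.meet (O.inv f) g = O.idY)
    (h : O.op f g = O.op y (O.op (O.inv y) z)) : y = O.idY := by
  obtain ⟨p, f₁, y₁, rfl, rfl, hfy⟩ := O.exists_meet_factorization f y
  have hfg₁ := meet_inv_eq_idY_of_op hfg
  rw [O.inv_op] at h
  simp only [O.op_assoc] at h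
  have h := O.cancel_left _ _ _ h
  have hy₁ : y₁ = O.idY := by
    obtain ⟨x', f', r, -, hgr, hwr, hxf, -, he1, hj2, -⟩ :=
      hO.exists_transport hf.of_op_right hg hfg₁ hfy h
    have hle := hj2.2.2 (O.op f' r) (hwr ▸ le_op _ _) (le_op _ _)
    have heq : O.inv (O.op (O.inv f₁) y₁) = O.op f' (O.inv x') := by
      rw [he1, O.inv_op, O.inv_invol]
    rw [heq, op_le_op_iff] at hle
    obtain ⟨s, rfl⟩ := (O.le_iff _ _).1 hle
    have hx' : x' = O.idY := by
      apply Admissible.eq_idY (x := O.idY) (z := s)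
      rw [O.id_op, ← hgr]
      exact hg
    rw [hx', O.op_id] at hxf
    exact eq_idY_of_le_of_le hfy (hxf ▸ le_op _ _) (O.le_refl _)
  subst hy₁
  rw [inv_idY, O.id_op, O.id_op] at h
  rw [O.op_id]
  have hmeet : O.meet f₁ (O.inv p) = O.idY := by
    obtain ⟨q, f₂, s, rfl, hs, hfs⟩ := O.exists_meet_factorization f₁ (O.inv p)
    have hp : p = O.op (O.inv s) (O.inv q) := by rw [← O.inv_op, ← hs, O.inv_invol]
    have hq : O.inv q = O.idY := by
      apply Admissible.eq_idY (x := O.inv s) (z := f₂)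
      rw [O.inv_invol, ← O.op_assoc, ← hp]
      exact hf
    have hq : q = O.idY := inv_eq_idY hq
    rwa [hs, hq, O.id_op, O.id_op]
  obtain ⟨x', f', r, -, rfl, -, hxf, hj1, -, -, -⟩ :=
    hO.exists_transport hf.of_op_right hg hfg₁ hmeet h
  have hx' : x' = O.idY :=
    eq_idY_of_le_of_le hfg (by rw [O.inv_op]; exact hj1.2.1) (le_op _ _)
  rw [hx', O.op_id] at hxf
  exact inv_eq_idY (eq_idY_of_le_of_le hmeet (hxf ▸ le_op _ _) (O.le_refl _))

end OreData

/-- If `f` and `g` are admissible elements of an ore which concatenate geodesically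
(`f⁻¹ ∧ g = id`), then `f □ g` is admissible. -/
theorem stmt11 {Y : Type} (O : OreData Y) (hO : O.IsOre) (f g : Y)
    (hf : O.Admissible f) (hg : O.Admissible g)
    (hconc : O.meet (O.inv f) g = O.idY) : O.Admissible (O.op f g) := by
  rintro ⟨x, y, z, hy, h⟩
  obtain ⟨p, f₁, x₁, rfl, rfl, hfx⟩ := O.exists_meet_factorization f x
  simp only [O.op_assoc] at h
  have h := O.cancel_left _ _ _ h
  obtain ⟨x', f', r, hf', rfl, hw, -, -, -, -, hgeo⟩ :=
    hO.exists_transport hf.of_op_right hg (OreData.meet_inv_eq_idY_of_op hconc) hfx h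
  exact hy (hO.eq_idY_of_op_eq_op_inv hf' hg.of_op_right hgeo hw.symm)
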